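/- No prime F_3-free split graph with split partition (K, I) contains 19 pairwise vertex-disjoint induced copies of the dart each having exactly three of its vertices in K and two of its vertices in I. -/

import Mathlib

variable {V : Type*}

/-- `(K, I)` is a split partition of `G`: every vertex is in `K` or `I`, the sets are
disjoint, `K` is a clique and `I` is an independent set. -/
def IsSplitPartition (G : SimpleGraph V) (K I : Set V) : Prop :=
  (∀ v, v ∈ K ∨ v ∈ I) ∧ Disjoint K I ∧
  (∀ u ∈ K, ∀ v ∈ K, u ≠ v → G.Adj u v) ∧
  (∀ u ∈ I, ∀ v ∈ I, ¬ G.Adj u v)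

/-- `G` is `H`-free: there is no induced-subgraph embedding of `H` into `G`,
i.e. no induced subgraph of `G` is isomorphic to `H`. -/
def HFree {W : Type*} (G : SimpleGraph V) (H : SimpleGraph W) : Prop :=
  IsEmpty (H ↪g G)

/-- The bull: vertices a,b,c,d,e = 0,1,2,3,4 with edges ab, bc, ca, ad, be. -/
def bull : SimpleGraph (Fin 5) :=
  SimpleGraph.fromRel (fun u v =>
    (u, v) ∈ ([(0,1),(1,2),(2,0),(0,3),(1,4)] : List (Fin 5 × Fin 5)))

/-- The dart: vertices a,b,c,d,e = 0,1,2,3,4 with edges ab, bc, ca, ad, be, bd. -/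
def dart : SimpleGraph (Fin 5) :=
  SimpleGraph.fromRel (fun u v =>
    (u, v) ∈ ([(0,1),(1,2),(2,0),(0,3),(1,4),(1,3)] : List (Fin 5 × Fin 5)))

/-- `F₁`: a `K₄` on vertices a,b,c,d = 0,1,2,3, a vertex e = 4 adjacent only to a,
and a vertex f = 5 adjacent only to d. -/
def F1 : SimpleGraph (Fin 6) :=
  SimpleGraph.fromRel (fun u v =>
    (u, v) ∈ ([(0,1),(0,2),(0,3),(1,2),(1,3),(2,3),(0,4),(3,5)] : List (Fin 6 × Fin 6)))

/-- `F₂`: a `K₄` on vertices a,b,c,d = 0,1,2,3, a vertex e = 4 adjacent only to a,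
and a vertex f = 5 adjacent only to c and d. -/
def F2 : SimpleGraph (Fin 6) :=
  SimpleGraph.fromRel (fun u v =>
    (u, v) ∈ ([(0,1),(0,2),(0,3),(1,2),(1,3),(2,3),(0,4),(2,5),(3,5)] : List (Fin 6 × Fin 6)))

/-- `F₃`: a `K₄` on vertices a,b,c,d = 0,1,2,3, a vertex z = 4 adjacent only to a and b,
and a vertex y = 5 adjacent only to b. -/
def F3 : SimpleGraph (Fin 6) :=
  SimpleGraph.fromRel (fun u v =>
    (u, v) ∈ ([(0,1),(0,2),(0,3),(1,2),(1,3),(2,3),(0,4),(1,4),(1,5)] : List (Fin 6 × Fin 6)))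

/-- `Q`: vertices j1,j2,j3,i1,i2,i3 = 0,1,2,3,4,5 with edges
j1j2, j1j3, j2j3, i1j1, i2j2, i3j2, i3j3. -/
def Qgraph : SimpleGraph (Fin 6) :=
  SimpleGraph.fromRel (fun u v =>
    (u, v) ∈ ([(0,1),(0,2),(1,2),(3,0),(4,1),(5,1),(5,2)] : List (Fin 6 × Fin 6)))

/-- `K_{1,3} + 2P₁`: a star with centre 0 and leaves 1,2,3, plus isolated vertices 4,5. -/
def K13_2P1 : SimpleGraph (Fin 6) :=
  SimpleGraph.fromRel (fun u v =>
    (u, v) ∈ ([(0,1),(0,2),(0,3)] : List (Fin 6 × Fin 6)))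

/-- A module of `G`: every vertex outside `M` is adjacent to all of `M` or to none of it. -/
def IsModule (G : SimpleGraph V) (M : Set V) : Prop :=
  ∀ v ∉ M, (∀ u ∈ M, G.Adj v u) ∨ (∀ u ∈ M, ¬ G.Adj v u)

/-- `G` is prime: every module of `G` is trivial (has at most one vertex,
or is the whole vertex set). -/
def IsPrime (G : SimpleGraph V) : Prop :=
  ∀ M : Set V, IsModule G M → M.Subsingleton ∨ M = Set.univ

/-- A dart split as a triangle `t 0, t 1, t 2` in `K` together with two vertices of `I`:
`w false`, adjacent to `t 0` and `t 1` only, and `w true`, adjacent to `t 1` only. -/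
structure IsSplitDart (G : SimpleGraph V) (K I : Set V) (t : Fin 3 → V) (w : Bool → V) :
    Prop where
  mem_K : ∀ m, t m ∈ K
  mem_I : ∀ s, w s ∈ I
  adj_a_d : G.Adj (t 0) (w false)
  adj_b : ∀ s, G.Adj (t 1) (w s)
  not_adj_a_e : ¬ G.Adj (t 0) (w true)
  not_adj_c : ∀ s, ¬ G.Adj (t 2) (w s)

/-- Two vertices have a common neighbour in `K`. -/
def Meets (G : SimpleGraph V) (K : Set V) (x y : V) : Prop :=
  ∃ v ∈ K, G.Adj v x ∧ G.Adj v y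

lemma Meets.symm {G : SimpleGraph V} {K : Set V} {x y : V} (h : Meets G K x y) :
    Meets G K y x :=
  let ⟨v, hv, hx, hy⟩ := h
  ⟨v, hv, hy, hx⟩

instance : DecidableRel dart.Adj := fun u v => by
  unfold dart
  rw [SimpleGraph.fromRel_adj]
  infer_instance

instance : DecidableRel F3.Adj := fun u v => by
  unfold F3
  rw [SimpleGraph.fromRel_adj]
  infer_instance

/-- A sextuple with the adjacencies of `F₃` is an induced copy of `F₃`. -/
lemma HFree.false_of_F3 {G : SimpleGraph V} (hfree : HFree G F3) {a b c d z y : V}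
    (hab : G.Adj a b) (hac : G.Adj a c) (had : G.Adj a d) (hbc : G.Adj b c)
    (hbd : G.Adj b d) (hcd : G.Adj c d) (haz : G.Adj a z) (hbz : G.Adj b z)
    (hby : G.Adj b y) (hcz : ¬ G.Adj c z) (hdz : ¬ G.Adj d z) (hzy : ¬ G.Adj z y)
    (hay : ¬ G.Adj a y) (hcy : ¬ G.Adj c y) (hdy : ¬ G.Adj d y) : False := by
  have hadj : ∀ i j, G.Adj (![a, b, c, d, z, y] i) (![a, b, c, d, z, y] j) ↔ F3.Adj i j := by
    intro i j
    fin_cases i <;> fin_cases j <;> simp [F3, *, G.adj_comm]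
  refine hfree.false ⟨⟨![a, b, c, d, z, y], fun i j hij => ?_⟩, hadj _ _⟩
  have hrow : ∀ k, F3.Adj k i ↔ F3.Adj k j := fun k => by rw [← hadj, ← hadj, hij]
  have hdet : ∀ i j : Fin 6, (∀ k, F3.Adj k i ↔ F3.Adj k j) → i = j := by decide
  exact hdet i j hrow

/-- An induced dart with three vertices in `K` and two in `I` is a split dart. -/
lemma exists_isSplitDart {G : SimpleGraph V} {K I : Set V} (h : IsSplitPartition G K I)
    (f : dart ↪g G) (S : Finset (Fin 5)) (hcard : S.card = 3) (hK : ∀ v ∈ S, f v ∈ K)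
    (hI : ∀ v ∉ S, f v ∈ I) :
    ∃ t w, IsSplitDart G K I t w ∧ Function.Injective w ∧
      (∀ m, t m ∈ Set.range f) ∧ ∀ s, w s ∈ Set.range f := by
  obtain ⟨-, -, hclique, -⟩ := h
  have hS : ∀ S : Finset (Fin 5), S.card = 3 → (∀ u ∈ S, ∀ v ∈ S, u ≠ v → dart.Adj u v) →
      S = {0, 1, 2} ∨ S = {0, 1, 3} := by decide
  have hdec : ∀ p q r u v : Fin 5, p ∈ S → q ∈ S → r ∈ S → u ∉ S → v ∉ S →
      dart.Adj p u → dart.Adj q u → dart.Adj q v → ¬ dart.Adj p v → ¬ dart.Adj r u →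
      ¬ dart.Adj r v → u ≠ v → ∃ t w, IsSplitDart G K I t w ∧ Function.Injective w ∧
      (∀ m, t m ∈ Set.range f) ∧ ∀ s, w s ∈ Set.range f := by
    intro p q r u v hp hq hr hu hv hpu hqu hqv hpv hru hrv huv
    refine ⟨![f p, f q, f r], fun s => f (bif s then v else u),
      ⟨?_, ?_, ?_, ?_, ?_, ?_⟩, ?_, ?_, fun s => ⟨_, rfl⟩⟩
    · simp [Fin.forall_fin_succ, *]
    · simp [*]
    · simpa using hpu
    · simp [*]
    · simpa using hpv
    · simp [*]
    · refine f.injective.comp fun s s' => ?_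
      cases s <;> cases s' <;> simp [huv, huv.symm]
    · simp [Fin.forall_fin_succ]
  rcases hS S hcard fun u hu v hv huv =>
    f.map_rel_iff.1 (hclique _ (hK u hu) _ (hK v hv) (f.injective.ne huv)) with rfl | rfl
  · exact hdec 0 1 2 3 4 (by decide) (by decide) (by decide) (by decide) (by decide)
      (by decide) (by decide) (by decide) (by decide) (by decide) (by decide) (by decide)
  · exact hdec 0 1 3 2 4 (by decide) (by decide) (by decide) (by decide) (by decide)
      (by decide) (by decide) (by decide) (by decide) (by decide) (by decide) (by decide)

/-- In a prime `F₃`-free split graph, two vertices of `I` with a common neighbour have at most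
one common non-neighbour in `K`. -/
lemma eq_of_not_adj_of_meets {G : SimpleGraph V} {K I : Set V} (h : IsSplitPartition G K I)
    (hprime : IsPrime G) (hfree : HFree G F3) {x y : V} (hx : x ∈ I) (hy : y ∈ I)
    (hxy : x ≠ y) (hmeet : Meets G K x y) {u v : V} (hu : u ∈ K) (hv : v ∈ K)
    (hux : ¬ G.Adj u x) (huy : ¬ G.Adj u y) (hvx : ¬ G.Adj v x) (hvy : ¬ G.Adj v y) :
    u = v := by
  obtain ⟨hcover, -, hclique, hindep⟩ := h
  obtain ⟨b, hb, hbx, hby⟩ := hmeet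
  by_contra huv
  have key : ∀ z ∈ I, ∀ y ∈ I, ∀ a ∈ K, G.Adj b z → G.Adj b y → ¬ G.Adj u z → ¬ G.Adj u y →
      ¬ G.Adj v z → ¬ G.Adj v y → G.Adj a z → G.Adj a y := by
    intro z hz y hy a ha hbz hby huz huy hvz hvy haz
    by_contra hay
    exact hfree.false_of_F3 (hclique a ha b hb fun e => hay (e ▸ hby))
      (hclique a ha u hu fun e => huz (e ▸ haz)) (hclique a ha v hv fun e => hvz (e ▸ haz))
      (hclique b hb u hu fun e => huz (e ▸ hbz)) (hclique b hb v hv fun e => hvz (e ▸ hbz))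
      (hclique u hu v hv huv) haz hbz hby huz hvz (hindep z hz y hy) hay huy hvy
  have hmod : IsModule G {x, y} := by
    intro a _
    by_cases ha : a ∈ K
    · have h₁ := key x hx y hy a ha hbx hby hux huy hvx hvy
      have h₂ := key y hy x hx a ha hby hbx huy hux hvy hvx
      by_cases hax : G.Adj a x
      · left; simp [hax, h₁ hax]
      · right; simp [hax, mt h₂ hax]
    · have haI := (hcover a).resolve_left ha
      right; simp [hindep a haI x hx, hindep a haI y hy]
  rcases hprime _ hmod with hs | huniv
  · exact hxy (hs (by simp) (by simp))
  · have hmem : b ∈ ({x, y} : Set V) := huniv ▸ Set.mem_univ b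
    rcases hmem with rfl | rfl
    · exact G.irrefl hbx
    · exact G.irrefl hby

/-- In an `F₃`-free split graph, the triangle of a split dart is not contained in the
neighbourhood of any vertex of `I`. -/
lemma IsSplitDart.exists_not_adj {G : SimpleGraph V} {K I : Set V} {t : Fin 3 → V}
    {w : Bool → V} (hd : IsSplitDart G K I t w) (h : IsSplitPartition G K I)
    (hfree : HFree G F3) {x : V} (hx : x ∈ I) : ∃ m, ¬ G.Adj (t m) x := by
  obtain ⟨-, -, hclique, hindep⟩ := h
  by_contra! hadj
  have hab : t 0 ≠ t 1 := fun e => hd.not_adj_a_e (e ▸ hd.adj_b true)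
  have hac : t 0 ≠ t 2 := fun e => hd.not_adj_c false (e ▸ hd.adj_a_d)
  have hbc : t 1 ≠ t 2 := fun e => hd.not_adj_c false (e ▸ hd.adj_b false)
  exact hfree.false_of_F3 (hclique _ (hd.mem_K 0) _ (hd.mem_K 1) hab)
    (hclique _ (hd.mem_K 0) _ (hd.mem_K 2) hac) (hadj 0)
    (hclique _ (hd.mem_K 1) _ (hd.mem_K 2) hbc) (hadj 1) (hadj 2) hd.adj_a_d
    (hd.adj_b false) (hd.adj_b true) (hd.not_adj_c false)
    (hindep _ hx _ (hd.mem_I false)) (hindep _ (hd.mem_I false) _ (hd.mem_I true))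
    hd.not_adj_a_e (hd.not_adj_c true) (hindep _ hx _ (hd.mem_I true))

/-- In a prime `F₃`-free split graph, the two `I`-vertices of a split dart have just one common
non-neighbour in `K`. -/
lemma IsSplitDart.exists_adj {G : SimpleGraph V} {K I : Set V} {t : Fin 3 → V}
    {w : Bool → V} (hd : IsSplitDart G K I t w) (h : IsSplitPartition G K I)
    (hprime : IsPrime G) (hfree : HFree G F3) {v : V} (hv : v ∈ K) (hvc : v ≠ t 2) :
    ∃ s, G.Adj v (w s) := by
  by_contra! hadj
  have hne : w false ≠ w true := fun e => hd.not_adj_a_e (e ▸ hd.adj_a_d)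
  exact hvc <| eq_of_not_adj_of_meets h hprime hfree (hd.mem_I false) (hd.mem_I true) hne
    ⟨t 1, hd.mem_K 1, hd.adj_b false, hd.adj_b true⟩ hv (hd.mem_K 2) (hadj false) (hadj true)
    (hd.not_adj_c false) (hd.not_adj_c true)

/-- Among the four pairs of `I`-vertices taken from two split darts, at most one fails to have
a common neighbour. -/
lemma IsSplitDart.exists_meets {G : SimpleGraph V} {K I : Set V} {t t' : Fin 3 → V}
    {w w' : Bool → V} (hd : IsSplitDart G K I t w) (hd' : IsSplitDart G K I t' w')
    (h : IsSplitPartition G K I) (hprime : IsPrime G) (hfree : HFree G F3)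
    (hbc : t 1 ≠ t' 2) (hbc' : t' 1 ≠ t 2) :
    ∃ p q, ∀ s s', s ≠ p ∨ s' ≠ q → Meets G K (w s) (w' s') := by
  by_cases hall : ∀ s s', Meets G K (w s) (w' s')
  · exact ⟨true, true, fun s s' _ => hall s s'⟩
  push Not at hall
  obtain ⟨p, q, hpq⟩ := hall
  obtain ⟨r', hr'⟩ := hd'.exists_adj h hprime hfree (hd.mem_K 1) hbc
  obtain ⟨r, hr⟩ := hd.exists_adj h hprime hfree (hd'.mem_K 1) hbc'
  have h₁ : ∀ s, Meets G K (w s) (w' r') := fun s => ⟨t 1, hd.mem_K 1, hd.adj_b s, hr'⟩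
  have h₂ : ∀ s', Meets G K (w r) (w' s') := fun s' => ⟨t' 1, hd'.mem_K 1, hr, hd'.adj_b s'⟩
  have hp : r ≠ p := fun e => hpq (e ▸ h₂ q)
  have hq : r' ≠ q := fun e => hpq (e ▸ h₁ p)
  refine ⟨p, q, fun s s' hs => ?_⟩
  rcases hs with hs | hs
  · obtain rfl : s = r := (Bool.eq_not_of_ne hs).trans (Bool.eq_not_of_ne hp).symm
    exact h₂ s'
  · obtain rfl : s' = r' := (Bool.eq_not_of_ne hs).trans (Bool.eq_not_of_ne hq).symm
    exact h₁ s

/-- Take four related pairs such that between any two of them at most one of the four possible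
relations is missing. Then four of their eight members are pairwise related. -/
lemma exists_four_pairwise {ι : Type*} {R : V → V → Prop} (hsymm : ∀ {x y}, R x y → R y x)
    (w : ι → Bool → V) (j : Fin 4 → ι) (hj : Function.Injective j)
    (hw : ∀ i, R (w i false) (w i true))
    (hcross : ∀ i i', i ≠ i' → ∃ p q, ∀ s s', s ≠ p ∨ s' ≠ q → R (w i s) (w i' s')) :
    ∃ g : Fin 4 → Fin 4 × Bool, Function.Injective g ∧
      ∀ k l, k ≠ l → R (w (j (g k).1) (g k).2) (w (j (g l).1) (g l).2) := by
  choose p q hpq using fun m : Fin 3 =>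
    hcross (j 0) (j m.succ) (hj.ne (Fin.succ_ne_zero m).symm)
  obtain ⟨m, m', hm, hp⟩ := Fintype.exists_ne_map_eq_of_card_lt p (by simp)
  have hm' : m.succ ≠ m'.succ := (Fin.succ_injective 3).ne hm
  obtain ⟨_, u, hu⟩ := hcross (j m.succ) (j m'.succ) (hj.ne hm')
  have h0 : ∀ s, R (w (j 0) (!p m)) (w (j m.succ) s) := fun s =>
    hpq m _ s (Or.inl (Bool.not_ne_self _))
  have h0' : ∀ s, R (w (j 0) (!p m)) (w (j m'.succ) s) := fun s =>
    hpq m' _ s (Or.inl (hp ▸ Bool.not_ne_self _))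
  have h1 : ∀ s, R (w (j m.succ) s) (w (j m'.succ) (!u)) := fun s =>
    hu s _ (Or.inr (Bool.not_ne_self _))
  refine ⟨![(0, !p m), (m.succ, false), (m.succ, true), (m'.succ, !u)], ?_, ?_⟩
  · intro k l
    have hne := (Fin.succ_ne_zero m).symm
    have hne' := (Fin.succ_ne_zero m').symm
    fin_cases k <;> fin_cases l <;> simp [hm, hm.symm, hne, hne', hne.symm, hne'.symm]
  · intro k l hkl
    fin_cases k <;> fin_cases l <;> first | exact absurd rfl hkl | skip
    exacts [h0 _, h0 _, h0' _, hsymm (h0 _), hw _, h1 _, hsymm (h0 _), hsymm (hw _), h1 _,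
      hsymm (h0' _), hsymm (h1 _), hsymm (h1 _)]

/-- No prime `F₃`-free split graph with split partition `(K, I)` contains 19 pairwise
vertex-disjoint induced copies of the dart, each having exactly three of its vertices in
`K` and two of its vertices in `I`. -/
theorem prime_F3_free_no_19_special_darts (G : SimpleGraph V) (K I : Set V)
    (h : IsSplitPartition G K I) (hprime : IsPrime G) (hfree : HFree G F3) :
    ¬ ∃ (f : Fin 19 → (dart ↪g G)) (S : Fin 19 → Finset (Fin 5)),
        (∀ i j, i ≠ j → Disjoint (Set.range (f i)) (Set.range (f j))) ∧
        (∀ i, (S i).card = 3) ∧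
        (∀ i, ∀ v ∈ S i, (f i) v ∈ K) ∧
        (∀ i, ∀ v ∉ S i, (f i) v ∈ I) := by
  rintro ⟨f, S, hdisj, hcard, hK, hI⟩
  choose t w hd hw_inj ht hw using fun i =>
    exists_isSplitDart h (f i) (S i) (hcard i) (hK i) (hI i)
  have hne : ∀ {i i' : Fin 19} {u v : V}, i ≠ i' → u ∈ Set.range (f i) →
      v ∈ Set.range (f i') → u ≠ v := fun hi hu hv => (hdisj _ _ hi).ne_of_mem hu hv
  have hemb := Fin.castLE_injective (show 4 ≤ 19 by norm_num)
  obtain ⟨g, hg, hmeet⟩ := exists_four_pairwise (R := Meets G K) Meets.symm w _ hemb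
    (fun i => ⟨t i 1, (hd i).mem_K 1, (hd i).adj_b false, (hd i).adj_b true⟩)
    (fun i i' hi => (hd i).exists_meets (hd i') h hprime hfree
      (hne hi (ht _ _) (ht _ _)) (hne hi.symm (ht _ _) (ht _ _)))
  set x : Fin 4 → V := fun k => w (Fin.castLE (by norm_num) (g k).1) (g k).2 with hx
  have hxI : ∀ k, x k ∈ I := fun k => (hd _).mem_I _
  have hx_inj : ∀ k l, k ≠ l → x k ≠ x l := by
    intro k l hkl
    by_cases h1 : (g k).1 = (g l).1
    · have h2 : (g k).2 ≠ (g l).2 := fun h2 => hkl (hg (Prod.ext h1 h2))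
      simpa only [hx, h1] using (hw_inj _).ne h2
    · exact hne (hemb.ne h1) (hw _ _) (hw _ _)
  have hshare : ∀ i, ∃ p : {p : Fin 4 × Fin 4 // p.1 ≠ p.2}, ∃ m,
      ¬ G.Adj (t i m) (x p.1.1) ∧ ¬ G.Adj (t i m) (x p.1.2) := by
    intro i
    choose m hm using fun k => (hd i).exists_not_adj h hfree (hxI k)
    obtain ⟨k, l, hkl, hml⟩ := Fintype.exists_ne_map_eq_of_card_lt m (by simp)
    exact ⟨⟨(k, l), hkl⟩, m k, hm k, hml ▸ hm l⟩
  choose p m hm using hshare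
  obtain ⟨i, i', hi, hp⟩ := Fintype.exists_ne_map_eq_of_card_lt p (by decide)
  exact hne hi (ht i (m i)) (ht i' (m i')) <|
    eq_of_not_adj_of_meets h hprime hfree (hxI _) (hxI _) (hx_inj _ _ (p i).2)
      (hmeet _ _ (p i).2) ((hd i).mem_K _) ((hd i').mem_K _) (hm i).1 (hm i).2
      (hp ▸ (hm i').1) (hp ▸ (hm i').2)
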